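/- arXiv:2007.03478 — 4 statements merged into one kernel-verified Lean document; each statement's English description precedes it below -/
import Mathlib

section
/- Let n, m, N be positive integers. Let A ∈ ℝ^{n×n} have all eigenvalues in the closed unit disc, let B ∈ ℝ^{n×m}, and let K ∈ ℝ^{m×n} be such that A − BK is Schur stable. Let D̄ = (d̄_{ij}) ∈ ℝ^{N×N} be lower triangular with all entries nonnegative and all diagonal entries satisfying d̄_{ii} < 1. Let κ_{1r}, …, κ_{Nr} ∈ ℕ satisfy κ_{ir} ≥ κ_{jr} whenever j < i and d̄_{ij} > 0; set κ_{ij} := κ_{ir} − κ_{jr} (and κ_{ij} := 0 when d̄_{ij} = 0), and let κ̂_{ij} ∈ ℕ be arbitrary with κ̂_{ii} = 0. Suppose x_r : ℤ → ℝ^n satisfies x_r(k+1) = A x_r(k) for all k ∈ ℤ, and x_i, χ_i : ℤ → ℝ^n (i = 1,…,N) satisfy, for all k ≥ 0: x_i(k+1) = A x_i(k) − B K χ_i(k) and χ_i(k+1) = A χ_i(k) − B K χ_i(k) + A ζ̄_i(k) − A ζ̂_i(k), where ζ̄_i(k) = x_i(k) − x_r(k − κ_{ir}) − Σ_{j=1}^{N}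 d̄_{ij} ( x_j(k − κ_{ij}) − x_r(k − κ_{ir}) ) and ζ̂_i(k) = χ_i(k) − Σ_{j=1}^{N} d̄_{ij} χ_j(k − κ̂_{ij}). Then for every i ∈ {1,…,N}, x_i(k) − x_r(k − κ_{ir}) → 0 as k → ∞, i.e., delayed regulated state synchronization is achieved for any N, any such D̄, and any unknown, non-uniform, arbitrarily large communication delays. -/
open Matrix Filter Finset

/-- Complexification of a real matrix (entrywise). -/
noncomputable def toC {ι κ : Type*} (M : Matrix ι κ ℝ) : Matrix ι κ ℂ :=
  M.map Complex.ofReal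

/-- A square complex matrix is Schur stable if all its eigenvalues lie in the
open unit disc. -/
def SchurStable {ι : Type*} [Fintype ι] [DecidableEq ι] (M : Matrix ι ι ℂ) : Prop :=
  ∀ z ∈ spectrum ℂ M, ‖z‖ < 1

open scoped NNReal ENNReal Topology

/-- In a complex Banach algebra, the powers of an element of spectral radius less than one
are absolutely summable. -/
theorem summable_norm_pow_of_spectralRadius_lt_one {R : Type*} [NormedRing R] [NormedAlgebra ℂ R]
    [CompleteSpace R] {a : R} (ha : spectralRadius ℂ a < 1) :
    Summable fun l : ℕ => ‖a ^ l‖ := by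
  obtain ⟨r, har, hr⟩ := ENNReal.lt_iff_exists_nnreal_btwn.1 ha
  have hr1 : (r : ℝ) < 1 := by exact_mod_cast hr
  have hev := (spectrum.pow_nnnorm_pow_one_div_tendsto_nhds_spectralRadius a).eventually_lt_const har
  refine Summable.of_norm_bounded_eventually_nat
    (summable_geometric_of_lt_one r.coe_nonneg hr1) ?_
  filter_upwards [hev, eventually_gt_atTop 0] with l hl hl0
  rw [norm_norm]
  have hl' : ((l : ℝ)) ≠ 0 := by positivity
  have h : ((‖a ^ l‖₊ : ℝ≥0∞) ^ (1 / l : ℝ)) ^ (l : ℝ) ≤ (r : ℝ≥0∞) ^ (l : ℝ) :=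
    ENNReal.rpow_le_rpow hl.le l.cast_nonneg
  rw [← ENNReal.rpow_mul, one_div_mul_cancel hl', ENNReal.rpow_one, ENNReal.rpow_natCast] at h
  exact_mod_cast h

/-- The powers of a Schur stable matrix vanish fast enough for the convolution with a null
sequence to be null. -/
theorem tendsto_sum_pow_mulVec {n : ℕ} {M : Matrix (Fin n) (Fin n) ℂ} (hM : SchurStable M)
    {w : ℕ → Fin n → ℂ} (hw : Tendsto w atTop (𝓝 0)) (v : Fin n → ℂ) :
    Tendsto (fun k => (M ^ k).mulVec v + ∑ l ∈ range k, (M ^ l).mulVec (w (k - 1 - l)))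
      atTop (𝓝 0) := by
  rcases Nat.eq_zero_or_pos n with rfl | hn
  · exact tendsto_const_nhds.congr fun k => Subsingleton.elim _ _
  open scoped Matrix.Norms.Operator in
  have : Nonempty (Fin n) := ⟨⟨0, hn⟩⟩
  have hsum : Summable fun l : ℕ => ‖M ^ l‖ := by
    have : CompleteSpace (Matrix (Fin n) (Fin n) ℂ) := FiniteDimensional.complete ℂ _
    refine summable_norm_pow_of_spectralRadius_lt_one ?_
    exact_mod_cast spectrum.spectralRadius_lt_of_forall_lt M (r := 1)
      fun z hz => by exact_mod_cast hM z hz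
  obtain ⟨W, hW⟩ := hw.norm.bddAbove_range
  have hW' : ∀ l, ‖w l‖ ≤ W := fun l => hW ⟨l, rfl⟩
  rw [← add_zero (0 : Fin n → ℂ)]
  refine Tendsto.add ?_ ?_
  · refine squeeze_zero_norm (fun k => linfty_opNorm_mulVec (M ^ k) v) ?_
    simpa using hsum.tendsto_atTop_zero.mul_const ‖v‖
  · have key := tendsto_tsum_of_dominated_convergence (𝓕 := atTop)
      (f := fun k l => if l ∈ range k then (M ^ l).mulVec (w (k - 1 - l)) else 0)
      (g := fun _ => (0 : Fin n → ℂ)) (hsum.mul_right W) ?_ ?_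
    · rw [tsum_zero] at key
      refine key.congr fun k => ?_
      rw [tsum_eq_sum (s := range k) fun l hl => if_neg hl]
      exact sum_congr rfl fun l hl => if_pos hl
    · intro l
      have hwl : Tendsto (fun k => (M ^ l).mulVec (w (k - 1 - l))) atTop (𝓝 0) := by
        have hc : Continuous fun u : Fin n → ℂ => (M ^ l).mulVec u := by fun_prop
        simpa [Function.comp_def] using (hc.tendsto 0).comp
          (hw.comp ((tendsto_sub_atTop_nat l).comp (tendsto_sub_atTop_nat 1)))
      refine hwl.congr' ?_
      filter_upwards [eventually_gt_atTop l] with k hk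
      rw [if_pos (mem_range.2 hk)]
    · refine Eventually.of_forall fun k l => ?_
      split_ifs
      · exact (linfty_opNorm_mulVec _ _).trans (by gcongr; exact hW' _)
      · simpa using mul_nonneg (norm_nonneg (M ^ l)) ((norm_nonneg _).trans (hW' 0))

/-- Solution formula for a forced linear recursion. -/
theorem eq_pow_mulVec_add_sum {n : ℕ} {R : Type*} [CommRing R] (M : Matrix (Fin n) (Fin n) R)
    {v w : ℕ → Fin n → R} (h : ∀ k, v (k + 1) = M.mulVec (v k) + w k) (k : ℕ) :
    v k = (M ^ k).mulVec (v 0) + ∑ l ∈ range k, (M ^ l).mulVec (w (k - 1 - l)) := by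
  induction k with
  | zero => simp
  | succ k ih =>
    rw [h, ih, sum_range_succ', mulVec_add, mulVec_mulVec, ← pow_succ', mulVec_sum, add_assoc]
    simp only [mulVec_mulVec, ← pow_succ', pow_zero, one_mulVec]
    congr 2
    refine sum_congr rfl fun l _ => ?_
    congr 2
    omega

/-- A Schur stable linear recursion driven by a null sequence has only null solutions. -/
theorem SchurStable.tendsto_zero {n : ℕ} {M : Matrix (Fin n) (Fin n) ℝ}
    (hM : SchurStable (toC M)) {v w : ℤ → Fin n → ℝ}
    (h : ∀ k : ℤ, 0 ≤ k → v (k + 1) = M.mulVec (v k) + w k) (hw : Tendsto w atTop (𝓝 0)) :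
    Tendsto v atTop (𝓝 0) := by
  let c : (Fin n → ℝ) → Fin n → ℂ := fun u i => u i
  have hc : Continuous c := by fun_prop
  have hrec : ∀ k : ℕ, c (v ((k + 1 : ℕ) : ℤ)) = (toC M).mulVec (c (v k)) + c (w k) := by
    intro k
    have hk := h k k.cast_nonneg
    ext i
    simp [c, hk, toC, mulVec, dotProduct]
  have hwc : Tendsto (fun k : ℕ => c (w k)) atTop (𝓝 0) := by
    have h0 : c 0 = 0 := by ext; simp [c]
    have := (hc.tendsto 0).comp (hw.comp tendsto_natCast_atTop_atTop)
    rwa [h0] at this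
  have hlim := (tendsto_sum_pow_mulVec hM hwc (c (v (0 : ℕ)))).congr fun k =>
    (eq_pow_mulVec_add_sum (v := fun k : ℕ => c (v k)) (toC M) hrec k).symm
  rw [← Nat.map_cast_int_atTop, tendsto_map'_iff, tendsto_pi_nhds]
  intro i
  simpa [c, Function.comp_def] using (Complex.continuous_re.tendsto _).comp (tendsto_pi_nhds.1 hlim i)

/-- Scaling by a factor in `[0, 1)` makes a matrix with spectrum in the closed unit disc
Schur stable. -/
theorem schurStable_toC_smul {n : ℕ} {A : Matrix (Fin n) (Fin n) ℝ}
    (hA : ∀ z ∈ spectrum ℂ (toC A), ‖z‖ ≤ 1) {d : ℝ} (hd : 0 ≤ d) (hd1 : d < 1) :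
    SchurStable (toC (d • A)) := by
  rcases Nat.eq_zero_or_pos n with rfl | hn
  · intro z hz
    rw [spectrum.of_subsingleton] at hz
    exact hz.elim
  have : Nonempty (Fin n) := ⟨⟨0, hn⟩⟩
  have hsmul : toC (d • A) = (d : ℂ) • toC A := by
    ext i j
    simp [toC]
  intro z hz
  rw [hsmul, spectrum.smul_eq_smul _ _
    (spectrum.nonempty_of_isAlgClosed_of_finiteDimensional ℂ _)] at hz
  obtain ⟨y, hy, rfl⟩ := hz
  have hy1 := hA y hy
  simp only [norm_smul, Complex.norm_real, Real.norm_of_nonneg hd]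
  nlinarith [norm_nonneg y]

/-- Theorem 1 of the paper: scale-free delayed regulated state synchronization
for homogeneous MAS with full-state coupling (Protocol 1). -/
theorem stmt0
    (n m N : ℕ) (hn : 0 < n) (hm : 0 < m) (hN : 0 < N)
    (A : Matrix (Fin n) (Fin n) ℝ) (B : Matrix (Fin n) (Fin m) ℝ)
    (K : Matrix (Fin m) (Fin n) ℝ)
    -- all eigenvalues of A are in the closed unit disc
    (hA : ∀ z ∈ spectrum ℂ (toC A), ‖z‖ ≤ 1)
    -- A - BK is Schur stable
    (hABK : SchurStable (toC (A - B * K)))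
    -- D̄ lower triangular, nonnegative entries, diagonal entries < 1
    (D : Matrix (Fin N) (Fin N) ℝ)
    (hDlt : ∀ i j : Fin N, i < j → D i j = 0)
    (hDnonneg : ∀ i j : Fin N, 0 ≤ D i j)
    (hDdiag : ∀ i : Fin N, D i i < 1)
    -- delays
    (κ : Fin N → ℕ)
    (hκ : ∀ i j : Fin N, j < i → 0 < D i j → κ j ≤ κ i)
    (κh : Fin N → Fin N → ℕ) (hκh : ∀ i : Fin N, κh i i = 0)
    -- exosystem
    (xr : ℤ → Fin n → ℝ)
    (hxr : ∀ k : ℤ, xr (k + 1) = A.mulVec (xr k))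
    -- agents and protocol states
    (x χ : Fin N → ℤ → Fin n → ℝ)
    -- network measurement ζ̄ and localized information exchange ζ̂
    (ζbar ζhat : Fin N → ℤ → Fin n → ℝ)
    (hζbar : ∀ (i : Fin N) (k : ℤ), ζbar i k =
      x i k - xr (k - (κ i : ℤ)) -
        ∑ j : Fin N, D i j •
          (x j (k - (if 0 < D i j then (κ i : ℤ) - (κ j : ℤ) else 0)) - xr (k - (κ i : ℤ))))
    (hζhat : ∀ (i : Fin N) (k : ℤ), ζhat i k =
      χ i k - ∑ j : Fin N, D i j • χ j (k - (κh i j : ℤ)))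
    -- closed-loop dynamics for k ≥ 0
    (hx : ∀ (i : Fin N) (k : ℤ), 0 ≤ k →
      x i (k + 1) = A.mulVec (x i k) - (B * K).mulVec (χ i k))
    (hχ : ∀ (i : Fin N) (k : ℤ), 0 ≤ k →
      χ i (k + 1) = A.mulVec (χ i k) - (B * K).mulVec (χ i k)
        + A.mulVec (ζbar i k) - A.mulVec (ζhat i k)) :
    -- delayed regulated state synchronization
    ∀ i : Fin N, Tendsto (fun k : ℤ => x i k - xr (k - (κ i : ℤ))) atTop (nhds 0) := by
  set e : Fin N → ℤ → Fin n → ℝ := fun i k => x i k - xr (k - (κ i : ℤ)) with he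
  set τ : Fin N → Fin N → ℤ := fun i j => if 0 < D i j then (κ i : ℤ) - (κ j : ℤ) else 0 with hτ
  have hτii : ∀ i, τ i i = 0 := fun i => by simp [hτ]
  have he_succ : ∀ i k, 0 ≤ k → e i (k + 1) = A.mulVec (e i k) - (B * K).mulVec (χ i k) := by
    intro i k hk
    have hr : xr (k + 1 - (κ i : ℤ)) = A.mulVec (xr (k - (κ i : ℤ))) := by
      rw [← hxr]; congr 1; ring
    simp only [he, hx i k hk, hr, mulVec_sub]
    abel
  have hζe : ∀ i k, ζbar i k = e i k - ∑ j, D i j • e j (k - τ i j) := by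
    intro i k
    rw [hζbar]
    congr 1
    refine sum_congr rfl fun j _ => ?_
    rcases (hDnonneg i j).eq_or_lt with h0 | h0
    · simp [← h0]
    · simp only [he, hτ, if_pos h0]
      rw [show k - ((κ i : ℤ) - (κ j : ℤ)) - (κ j : ℤ) = k - (κ i : ℤ) by ring]
  have hδ_succ : ∀ i k, 0 ≤ k → e i (k + 1) - χ i (k + 1) =
      (D i i • A).mulVec (e i k - χ i k) + A.mulVec (∑ j ∈ univ.erase i,
        D i j • (e j (k - τ i j) - χ j (k - (κh i j : ℤ)))) := by
    intro i k hk
    have hsum : (∑ j, D i j • e j (k - τ i j)) - ∑ j, D i j • χ j (k - (κh i j : ℤ)) =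
        D i i • (e i k - χ i k) +
          ∑ j ∈ univ.erase i, D i j • (e j (k - τ i j) - χ j (k - (κh i j : ℤ))) := by
      rw [← sum_sub_distrib, ← add_sum_erase _ _ (mem_univ i)]
      simp [hτii, hκh, smul_sub]
    rw [smul_mulVec, ← mulVec_smul, ← mulVec_add, ← hsum, he_succ i k hk, hχ i k hk, hζe, hζhat]
    simp only [mulVec_sub]
    abel
  have main : ∀ i, Tendsto (e i) atTop (nhds 0) ∧ Tendsto (χ i) atTop (nhds 0) := by
    intro i
    induction i using WellFoundedLT.induction with
    | ind i ih =>
    have hw : Tendsto (fun k => A.mulVec (∑ j ∈ univ.erase i,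
        D i j • (e j (k - τ i j) - χ j (k - (κh i j : ℤ))))) atTop (nhds 0) := by
      have hs : Tendsto (fun k => ∑ j ∈ univ.erase i,
          D i j • (e j (k - τ i j) - χ j (k - (κh i j : ℤ)))) atTop (nhds 0) := by
        rw [← sum_const_zero (s := univ.erase i)]
        refine tendsto_finsetSum _ fun j hj => ?_
        rcases lt_or_gt_of_ne (ne_of_mem_erase hj) with hji | hij
        · have hshift : ∀ c : ℤ, Tendsto (fun k : ℤ => k - c) atTop atTop :=
            fun c => tendsto_atTop_add_const_right _ (-c) tendsto_id
          simpa using (((ih j hji).1.comp (hshift (τ i j))).sub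
            ((ih j hji).2.comp (hshift (κh i j)))).const_smul (D i j)
        · simp [hDlt i j hij]
      have hcA : Continuous fun u : Fin n → ℝ => A.mulVec u := by fun_prop
      simpa [Function.comp_def] using (hcA.tendsto 0).comp hs
    have hδ : Tendsto (fun k => e i k - χ i k) atTop (nhds 0) :=
      (schurStable_toC_smul hA (hDnonneg i i) (hDdiag i)).tendsto_zero
        (v := fun k => e i k - χ i k) (hδ_succ i) hw
    have hei : Tendsto (e i) atTop (nhds 0) := by
      refine hABK.tendsto_zero (w := fun k => (B * K).mulVec (e i k - χ i k)) ?_ ?_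
      · intro k hk
        rw [he_succ i k hk, sub_mulVec, mulVec_sub _ (e i k) (χ i k)]
        abel
      · have hcBK : Continuous fun u : Fin n → ℝ => (B * K).mulVec u := by fun_prop
        simpa [Function.comp_def] using (hcBK.tendsto 0).comp hδ
    exact ⟨hei, by simpa using hei.sub hδ⟩
  exact fun i => (main i).1
end

section
/- Let n, m, p, N be positive integers. Let A ∈ ℝ^{n×n} have all eigenvalues in the closed unit disc, let B ∈ ℝ^{n×m}, C ∈ ℝ^{p×n}, let K ∈ ℝ^{m×n} be such that A − BK is Schur stable, and let H ∈ ℝ^{n×p} be such that A − HC is Schur stable. Let D̄ = (d̄_{ij}) ∈ ℝ^{N×N} be lower triangular with all entries nonnegative and all diagonal entries satisfying d̄_{ii} < 1. Let κ_{1r}, …, κ_{Nr} ∈ ℕ satisfy κ_{ir} ≥ κ_{jr} whenever j < i and d̄_{ij} > 0; set κ_{ij} := κ_{ir} − κ_{jr} (and κ_{ij} := 0 when d̄_{ij} = 0), and let κ̂_{ij} ∈ ℕ be arbitrary with κ̂_{ii} = 0. Suppose x_r : ℤ → ℝ^n satisfies x_r(k+1) = A x_r(k) for all k ∈ ℤ,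 and x_i, x̂_i, χ_i : ℤ → ℝ^n (i = 1,…,N) satisfy, for all k ≥ 0: x_i(k+1) = A x_i(k) − B K χ_i(k), x̂_i(k+1) = A x̂_i(k) − B K ζ̂_i(k) + H( ζ̄_i(k) − C x̂_i(k) ), and χ_i(k+1) = A χ_i(k) − B K χ_i(k) + A x̂_i(k) − A ζ̂_i(k), where ζ̄_i(k) = C x_i(k) − C x_r(k − κ_{ir}) − Σ_{j=1}^{N} d̄_{ij} ( C x_j(k − κ_{ij}) − C x_r(k − κ_{ir}) ) and ζ̂_i(k) = χ_i(k) − Σ_{j=1}^{N} d̄_{ij} χ_j(k − κ̂_{ij}). Then for every i ∈ {1,…,N}, x_i(k) − x_r(k − κ_{ir}) → 0 as k → ∞. -/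
open Matrix Filter Finset

/-- A nonnegative real sequence which contracts up to a vanishing perturbation tends to zero. -/
theorem tendsto_zero_of_le_mul_add {a b : ℕ → ℝ} {q : ℝ} (hq0 : 0 ≤ q) (hq1 : q < 1)
    (ha : ∀ k, 0 ≤ a k) (hab : ∀ k, a (k + 1) ≤ q * a k + b k)
    (hb : Tendsto b atTop (nhds 0)) : Tendsto a atTop (nhds 0) := by
  rw [Metric.tendsto_atTop]
  intro ε hε
  have hδ : 0 < (1 - q) * (ε / 2) := mul_pos (by linarith) (by linarith)
  obtain ⟨k₀, hk₀⟩ := eventually_atTop.1 (hb.eventually_le_const hδ)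
  have hgeom : ∀ j, a (k₀ + j) ≤ q ^ j * a k₀ + ε / 2 := by
    intro j
    induction j with
    | zero => simp; linarith
    | succ j ih =>
      have h₁ := hab (k₀ + j)
      have h₂ := hk₀ (k₀ + j) (Nat.le_add_right _ _)
      have h₃ := mul_le_mul_of_nonneg_left ih hq0
      rw [← add_assoc, pow_succ']
      linarith
  have hpow : Tendsto (fun j : ℕ => q ^ j * a k₀) atTop (nhds 0) := by
    simpa using (tendsto_pow_atTop_nhds_zero_of_lt_one hq0 hq1).mul_const (a k₀)
  obtain ⟨j₀, hj₀⟩ := eventually_atTop.1 (hpow.eventually_lt_const (half_pos hε))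
  refine ⟨k₀ + j₀, fun k hk => ?_⟩
  obtain ⟨j, rfl⟩ := Nat.exists_eq_add_of_le (le_of_add_le_left hk)
  have h₁ := hgeom j
  have h₂ := hj₀ j (by omega)
  rw [Real.dist_eq, sub_zero, abs_of_nonneg (ha _)]
  linarith

/-- An element of a complex Banach algebra with spectrum in the open unit disc has a power whose
norm is at most the same power of some `r < 1`. -/
theorem exists_norm_pow_le_pow_of_spectrum {𝔸 : Type*} [NormedRing 𝔸] [NormedAlgebra ℂ 𝔸]
    [CompleteSpace 𝔸] [Nontrivial 𝔸] (a : 𝔸) (ha : ∀ z ∈ spectrum ℂ a, ‖z‖ < 1) :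
    ∃ r : ℝ, 0 < r ∧ r < 1 ∧ ∃ l : ℕ, ‖a ^ l‖ ≤ r ^ l ∧ 0 < l := by
  have hρ : spectralRadius ℂ a < (1 : NNReal) :=
    spectrum.spectralRadius_lt_of_forall_lt a fun z hz => by exact_mod_cast ha z hz
  obtain ⟨r, hρr, hr1⟩ := ENNReal.lt_iff_exists_nnreal_btwn.1 hρ
  have hr0 : 0 < r := ENNReal.coe_pos.1 (bot_le.trans_lt hρr)
  obtain ⟨l, hl, hl0⟩ := (((spectrum.pow_nnnorm_pow_one_div_tendsto_nhds_spectralRadius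
    a).eventually_lt_const hρr).and (eventually_gt_atTop 0)).exists
  refine ⟨r, hr0, by exact_mod_cast hr1, l, ?_, hl0⟩
  have hl' : (0 : ℝ) < l := by exact_mod_cast hl0
  rw [one_div, ENNReal.rpow_inv_lt_iff hl', ENNReal.rpow_natCast] at hl
  exact_mod_cast hl.le

/-- The Schur stable matrices have a power contracting the supremum norm. -/
theorem SchurStable.exists_norm_pow_mulVec_le {n : ℕ} (hn : 0 < n)
    {M : Matrix (Fin n) (Fin n) ℝ} (hM : SchurStable (toC M)) :
    ∃ r : ℝ, 0 < r ∧ r < 1 ∧ ∃ l : ℕ, 0 < l ∧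
      ∀ v : Fin n → ℝ, ‖(M ^ l) *ᵥ v‖ ≤ r ^ l * ‖v‖ := by
  have : Nonempty (Fin n) := ⟨⟨0, hn⟩⟩
  let _ := Matrix.linftyOpNormedRing (n := Fin n) (α := ℂ)
  let _ := Matrix.linftyOpNormedAlgebra (R := ℂ) (n := Fin n) (α := ℂ)
  have : CompleteSpace (Matrix (Fin n) (Fin n) ℂ) := FiniteDimensional.complete ℂ _
  obtain ⟨r, hr0, hr1, l, hl, hl0⟩ := exists_norm_pow_le_pow_of_spectrum (toC M) hM
  refine ⟨r, hr0, hr1, l, hl0, fun v => ?_⟩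
  have hnorm : ∀ w : Fin n → ℝ, ‖Complex.ofRealHom ∘ w‖ = ‖w‖ := fun w => by
    simp [Pi.norm_def, Complex.nnnorm_real]
  have hmap : Complex.ofRealHom ∘ ((M ^ l) *ᵥ v) = (toC M ^ l) *ᵥ (Complex.ofRealHom ∘ v) := by
    have hpow : (M ^ l).map Complex.ofRealHom = toC M ^ l :=
      map_pow Complex.ofRealHom.mapMatrix M l
    rw [← hpow]
    exact funext fun i => RingHom.map_mulVec _ _ _ i
  rw [← hnorm, ← hnorm, hmap]
  exact (Matrix.linfty_opNorm_mulVec _ _).trans (by gcongr)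

/-- A Schur stable linear recursion driven by a vanishing input has vanishing state. -/
theorem SchurStable.tendsto_zero_s1 {n : ℕ} (hn : 0 < n) {M : Matrix (Fin n) (Fin n) ℝ}
    (hM : SchurStable (toC M)) {z f : ℤ → Fin n → ℝ}
    (hz : ∀ k : ℤ, 0 ≤ k → z (k + 1) = M *ᵥ z k + f k)
    (hf : Tendsto f atTop (nhds 0)) : Tendsto z atTop (nhds 0) := by
  obtain ⟨r, hr0, hr1, l, hl0, hl⟩ := hM.exists_norm_pow_mulVec_le hn
  -- A weighted sum of norms along the powers of `M` is a Lyapunov function.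
  let V : (Fin n → ℝ) → ℝ := fun v => ∑ i ∈ range l, r⁻¹ ^ i * ‖(M ^ i) *ᵥ v‖
  have hV0 : ∀ v, 0 ≤ V v := fun v => by positivity
  have hVle : ∀ v, ‖v‖ ≤ V v := fun v => by
    have := single_le_sum (f := fun i => r⁻¹ ^ i * ‖(M ^ i) *ᵥ v‖)
      (fun i _ => by positivity) (mem_range.2 hl0)
    simpa [V] using this
  have hVadd : ∀ v w, V (v + w) ≤ V v + V w := fun v w => by
    simp only [V, ← sum_add_distrib, ← mul_add, mulVec_add]
    gcongr
    exact norm_add_le _ _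
  have hVM : ∀ v, V (M *ᵥ v) ≤ r * V v := fun v => by
    have hshift : r⁻¹ * V (M *ᵥ v) = ∑ i ∈ range l, r⁻¹ ^ (i + 1) * ‖(M ^ (i + 1)) *ᵥ v‖ := by
      simp only [V, mul_sum, mulVec_mulVec, ← pow_succ, ← mul_assoc, ← pow_succ']
    have htel := (sum_range_succ' (fun i => r⁻¹ ^ i * ‖(M ^ i) *ᵥ v‖) l).symm.trans
      (sum_range_succ _ l)
    have hlast : r⁻¹ ^ l * ‖(M ^ l) *ᵥ v‖ ≤ ‖v‖ := by
      rw [inv_pow, inv_mul_le_iff₀ (pow_pos hr0 l)]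
      exact hl v
    simp only [← hshift, pow_zero, one_mulVec, one_mul] at htel
    rw [← inv_mul_le_iff₀ hr0]
    change _ = V v + _ at htel
    linarith
  have hVcont : Continuous V := by
    refine continuous_finsetSum _ fun i _ => continuous_const.mul (Continuous.norm ?_)
    exact continuous_const.matrix_mulVec continuous_id
  rw [← Nat.map_cast_int_atTop, tendsto_map'_iff] at hf ⊢
  have hVf : Tendsto (fun k : ℕ => V (f k)) atTop (nhds 0) := by
    simpa [V, Function.comp_def] using (hVcont.tendsto 0).comp hf
  have hVz : Tendsto (fun k : ℕ => V (z k)) atTop (nhds 0) := by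
    refine tendsto_zero_of_le_mul_add hr0.le hr1 (fun k => hV0 _) (fun k => ?_) hVf
    rw [Nat.cast_succ, hz k (Int.natCast_nonneg k)]
    exact (hVadd _ _).trans (by gcongr; exact hVM _)
  exact squeeze_zero_norm (fun k => hVle _) hVz

/-- Shrinking a matrix whose eigenvalues lie in the closed unit disc makes it Schur stable. -/
theorem schurStable_smul {n : ℕ} (hn : 0 < n) {M : Matrix (Fin n) (Fin n) ℝ}
    (hM : ∀ z ∈ spectrum ℂ (toC M), ‖z‖ ≤ 1) {d : ℝ} (hd0 : 0 ≤ d) (hd1 : d < 1) :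
    SchurStable (toC (d • M)) := by
  have : Nonempty (Fin n) := ⟨⟨0, hn⟩⟩
  have hsmul : toC (d • M) = (d : ℂ) • toC M := by
    ext i j
    simp [toC]
  intro z hz
  rw [hsmul, spectrum.smul_eq_smul _ _
    (spectrum.nonempty_of_isAlgClosed_of_finiteDimensional ℂ _)] at hz
  obtain ⟨w, hw, rfl⟩ := hz
  have h₁ := mul_le_mul_of_nonneg_left (hM w hw) hd0
  simp only [norm_smul, Complex.norm_real, Real.norm_eq_abs, abs_of_nonneg hd0]
  linarith

/-- A fixed matrix preserves convergence to zero. -/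
theorem tendsto_mulVec_zero {α : Type*} {l : Filter α} {m n : ℕ} (M : Matrix (Fin m) (Fin n) ℝ)
    {f : α → Fin n → ℝ} (hf : Tendsto f l (nhds 0)) :
    Tendsto (fun k => M *ᵥ f k) l (nhds 0) := by
  have hcont : Continuous fun v : Fin n → ℝ => M *ᵥ v :=
    continuous_const.matrix_mulVec continuous_id
  simpa [Function.comp_def] using (hcont.tendsto 0).comp hf

/-- Delayed weighted sums over the strict predecessors of `i` vanish when the predecessors do. -/
theorem tendsto_sum_erase_delay {n N : ℕ} {D : Matrix (Fin N) (Fin N) ℝ}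
    (hD : ∀ i j : Fin N, i < j → D i j = 0) (i : Fin N) (τ : Fin N → ℤ)
    {f : Fin N → ℤ → Fin n → ℝ} (hf : ∀ j < i, Tendsto (f j) atTop (nhds 0)) :
    Tendsto (fun k : ℤ => ∑ j ∈ univ.erase i, D i j • f j (k - τ j)) atTop (nhds 0) := by
  rw [← sum_const_zero (s := univ.erase i)]
  refine tendsto_finsetSum _ fun j hj => ?_
  rcases lt_or_gt_of_ne (ne_of_mem_erase hj) with h | h
  · have hshift : Tendsto (fun k : ℤ => k - τ j) atTop atTop :=
      tendsto_atTop_add_const_right _ (-τ j) tendsto_id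
    simpa using ((hf j h).comp hshift).const_smul (D i j)
  · simp [hD i j h]

/-- Theorem 2 of the paper: scale-free delayed regulated state synchronization
for homogeneous MAS with partial-state coupling (Protocol 2). -/
theorem stmt1
    (n m p N : ℕ) (hn : 0 < n) (hm : 0 < m) (hp : 0 < p) (hN : 0 < N)
    (A : Matrix (Fin n) (Fin n) ℝ) (B : Matrix (Fin n) (Fin m) ℝ)
    (C : Matrix (Fin p) (Fin n) ℝ)
    (K : Matrix (Fin m) (Fin n) ℝ) (H : Matrix (Fin n) (Fin p) ℝ)
    -- all eigenvalues of A are in the closed unit disc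
    (hA : ∀ z ∈ spectrum ℂ (toC A), ‖z‖ ≤ 1)
    -- A - BK and A - HC are Schur stable
    (hABK : SchurStable (toC (A - B * K)))
    (hAHC : SchurStable (toC (A - H * C)))
    -- D̄ lower triangular, nonnegative entries, diagonal entries < 1
    (D : Matrix (Fin N) (Fin N) ℝ)
    (hDlt : ∀ i j : Fin N, i < j → D i j = 0)
    (hDnonneg : ∀ i j : Fin N, 0 ≤ D i j)
    (hDdiag : ∀ i : Fin N, D i i < 1)
    -- delays
    (κ : Fin N → ℕ)
    (hκ : ∀ i j : Fin N, j < i → 0 < D i j → κ j ≤ κ i)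
    (κh : Fin N → Fin N → ℕ) (hκh : ∀ i : Fin N, κh i i = 0)
    -- exosystem
    (xr : ℤ → Fin n → ℝ)
    (hxr : ∀ k : ℤ, xr (k + 1) = A.mulVec (xr k))
    -- agents and protocol states
    (x xhat χ : Fin N → ℤ → Fin n → ℝ)
    -- network measurement ζ̄ (output coupling) and localized exchange ζ̂
    (ζbar : Fin N → ℤ → Fin p → ℝ) (ζhat : Fin N → ℤ → Fin n → ℝ)
    (hζbar : ∀ (i : Fin N) (k : ℤ), ζbar i k =
      C.mulVec (x i k) - C.mulVec (xr (k - (κ i : ℤ))) -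
        ∑ j : Fin N, D i j •
          (C.mulVec (x j (k - (if 0 < D i j then (κ i : ℤ) - (κ j : ℤ) else 0)))
            - C.mulVec (xr (k - (κ i : ℤ)))))
    (hζhat : ∀ (i : Fin N) (k : ℤ), ζhat i k =
      χ i k - ∑ j : Fin N, D i j • χ j (k - (κh i j : ℤ)))
    -- closed-loop dynamics for k ≥ 0
    (hx : ∀ (i : Fin N) (k : ℤ), 0 ≤ k →
      x i (k + 1) = A.mulVec (x i k) - (B * K).mulVec (χ i k))
    (hxhat : ∀ (i : Fin N) (k : ℤ), 0 ≤ k →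
      xhat i (k + 1) = A.mulVec (xhat i k) - (B * K).mulVec (ζhat i k)
        + H.mulVec (ζbar i k - C.mulVec (xhat i k)))
    (hχ : ∀ (i : Fin N) (k : ℤ), 0 ≤ k →
      χ i (k + 1) = A.mulVec (χ i k) - (B * K).mulVec (χ i k)
        + A.mulVec (xhat i k) - A.mulVec (ζhat i k)) :
    -- delayed regulated state synchronization
    ∀ i : Fin N, Tendsto (fun k : ℤ => x i k - xr (k - (κ i : ℤ))) atTop (nhds 0) := by
  -- The delayed synchronization errors.
  let e : Fin N → ℤ → Fin n → ℝ := fun i k => x i k - xr (k - (κ i : ℤ))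
  let τ : Fin N → Fin N → ℤ := fun i j => if 0 < D i j then (κ i : ℤ) - (κ j : ℤ) else 0
  have hτ : ∀ i, τ i i = 0 := fun i => by simp [τ]
  have he : ∀ (i : Fin N) (k : ℤ), 0 ≤ k →
      e i (k + 1) = A *ᵥ e i k - (B * K) *ᵥ χ i k := fun i k hk => by
    simp only [e]
    rw [hx i k hk, show k + 1 - (κ i : ℤ) = k - κ i + 1 by ring, hxr, mulVec_sub]
    abel
  have hζe : ∀ i k, ζbar i k = C *ᵥ (e i k - ∑ j, D i j • e j (k - τ i j)) := fun i k => by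
    rw [hζbar, mulVec_sub, mulVec_sum]
    simp only [e, mulVec_sub, mulVec_smul]
    congr 1
    refine sum_congr rfl fun j _ => ?_
    rcases (hDnonneg i j).eq_or_lt with h | h
    · simp [← h]
    · simp only [τ, if_pos h]
      rw [show k - ((κ i : ℤ) - κ j) - κ j = k - κ i by ring]
  suffices hmain : ∀ i, Tendsto (e i) atTop (nhds 0) ∧ Tendsto (χ i) atTop (nhds 0) from
    fun i => (hmain i).1
  intro i
  induction i using WellFoundedLT.induction with
  | _ i ih =>
  let d : ℝ := D i i
  let v : ℤ → Fin n → ℝ := fun k => ∑ j ∈ univ.erase i, D i j • e j (k - τ i j)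
  let w : ℤ → Fin n → ℝ := fun k => ∑ j ∈ univ.erase i, D i j • χ j (k - (κh i j : ℤ))
  have hv : Tendsto v atTop (nhds 0) :=
    tendsto_sum_erase_delay hDlt i (τ i) fun j hj => (ih j hj).1
  have hw : Tendsto w atTop (nhds 0) :=
    tendsto_sum_erase_delay hDlt i (fun j => (κh i j : ℤ)) fun j hj => (ih j hj).2
  have hζv : ∀ k, ζbar i k = C *ᵥ ((1 - d) • e i k - v k) := fun k => by
    rw [hζe, ← add_sum_erase _ _ (mem_univ i), hτ, sub_zero, sub_smul, one_smul,
      sub_sub (e i k)]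
  have hζw : ∀ k, ζhat i k = (1 - d) • χ i k - w k := fun k => by
    rw [hζhat, ← add_sum_erase _ _ (mem_univ i), hκh, Nat.cast_zero, sub_zero, sub_smul, one_smul,
      sub_sub]
  -- The observer error.
  let s : ℤ → Fin n → ℝ := fun k => xhat i k - (1 - d) • e i k
  have hs : Tendsto s atTop (nhds 0) := by
    refine hAHC.tendsto_zero_s1 hn (f := fun k => (B * K) *ᵥ w k - (H * C) *ᵥ v k) (fun k hk => ?_) ?_
    · simp only [s]
      rw [hxhat i k hk, he i k hk, hζv, hζw]
      simp only [mulVec_sub, mulVec_smul, sub_mulVec, ← mulVec_mulVec, smul_sub]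
      abel
    · simpa using (tendsto_mulVec_zero (B * K) hw).sub (tendsto_mulVec_zero (H * C) hv)
  -- The mismatch between the protocol state and the synchronization error.
  let g : ℤ → Fin n → ℝ := fun k => χ i k - e i k
  have hg : Tendsto g atTop (nhds 0) := by
    refine (schurStable_smul hn hA (hDnonneg i i) (hDdiag i)).tendsto_zero_s1 hn
      (f := fun k => A *ᵥ s k + A *ᵥ w k) (fun k hk => ?_) ?_
    · simp only [g, s]
      rw [hχ i k hk, he i k hk, hζw]
      simp only [mulVec_sub, mulVec_smul, smul_mulVec]
      change _ = d • _ - d • _ + _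
      module
    · simpa using (tendsto_mulVec_zero A hs).add (tendsto_mulVec_zero A hw)
  have hei : Tendsto (e i) atTop (nhds 0) := by
    refine hABK.tendsto_zero_s1 hn (f := fun k => -((B * K) *ᵥ g k)) (fun k hk => ?_) ?_
    · rw [he i k hk]
      simp only [g, sub_mulVec, mulVec_sub]
      abel
    · simpa using (tendsto_mulVec_zero (B * K) hg).neg
  exact ⟨hei, by simpa [g] using hg.add hei⟩
end

section
/- Let A ∈ ℝ^{n×n} have all eigenvalues in the closed unit disc and let K ∈ ℝ^{m×n}, B ∈ ℝ^{n×m} be such that A − BK is Schur stable. Let D̄ = (d̄_{ij}) ∈ ℝ^{N×N} be lower triangular with nonnegative entries and diagonal entries d̄_{ii} < 1, and let Δ ∈ ℂ^{N×N} be lower triangular with Δ_{ii} = d̄_{ii} for all i and, for i > j, Δ_{ij} = d̄_{ij} z_{ij} for some complex numbers z_{ij} of modulus 1. Then the complex block matrix [[I_N ⊗ (A − BK), I_N ⊗ (BK)], [(D̄ − Δ) ⊗ A, Δ ⊗ A]] has no eigenvalue on the unit circle (no eigenvalue of modulus 1). -/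
open Matrix Kronecker

theorem Matrix.mem_spectrum_iff_exists_mulVec_eq {ι : Type*} [Fintype ι] [DecidableEq ι]
    (M : Matrix ι ι ℂ) (z : ℂ) :
    z ∈ spectrum ℂ M ↔ ∃ v : ι → ℂ, v ≠ 0 ∧ M *ᵥ v = z • v := by
  rw [← Matrix.spectrum_toLin', ← Module.End.hasEigenvalue_iff_mem_spectrum]
  constructor
  · intro h
    obtain ⟨v, hv⟩ := h.exists_hasEigenvector
    exact ⟨v, hv.2, by simpa using hv.apply_eq_smul⟩
  · rintro ⟨v, hv, h⟩
    exact Module.End.hasEigenvalue_of_hasEigenvector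
      (Module.End.hasEigenvector_iff.mpr ⟨Module.End.mem_eigenspace_iff.mpr (by simpa using h), hv⟩)

/-- Slicewise form of the action of a Kronecker product on a vector. -/
theorem Matrix.kronecker_mulVec_apply {R ι κ μ ν : Type*} [Semiring R] [Fintype κ] [Fintype ν]
    (P : Matrix ι κ R) (Q : Matrix μ ν R) (v : κ × ν → R) (i : ι) (a : μ) :
    ((P ⊗ₖ Q) *ᵥ v) (i, a) = ∑ j, P i j * (Q *ᵥ fun b => v (j, b)) a := by
  simp only [Matrix.mulVec, dotProduct, Fintype.sum_prod_type, kroneckerMap_apply, Finset.mul_sum,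
    mul_assoc]

/-- A matrix whose eigenvalues lie in the closed unit disc, scaled by `d ∈ [0, 1)`, has no
eigenvector for an eigenvalue of modulus one. -/
theorem Matrix.eq_zero_of_smul_mulVec_eq {ι : Type*} [Fintype ι] [DecidableEq ι]
    {M : Matrix ι ι ℂ} (hM : ∀ z ∈ spectrum ℂ M, ‖z‖ ≤ 1) {d : ℝ} (hd0 : 0 ≤ d) (hd1 : d < 1)
    {z : ℂ} (hz : ‖z‖ = 1) {v : ι → ℂ} (hv : (d : ℂ) • (M *ᵥ v) = z • v) : v = 0 := by
  have hz0 : z ≠ 0 := norm_ne_zero_iff.mp (by simp [hz])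
  by_contra hne
  rcases hd0.eq_or_lt with rfl | hd
  · exact (smul_ne_zero hz0 hne) (by simpa using hv.symm)
  · have hdC : (d : ℂ) ≠ 0 := by exact_mod_cast hd.ne'
    have h := hM (z / d) ((Matrix.mem_spectrum_iff_exists_mulVec_eq M _).mpr ⟨v, hne, by
      rw [div_eq_inv_mul, mul_smul, ← hv, smul_smul, inv_mul_cancel₀ hdC, one_smul]⟩)
    rw [norm_div, hz, Complex.norm_of_nonneg hd.le, div_le_one hd] at h
    exact absurd hd1 h.not_gt

/-- Frequency-domain condition in the proof of Theorem 1: the delayed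
closed-loop matrix has no eigenvalue on the unit circle. -/
theorem stmt5
    (n m N : ℕ)
    (A : Matrix (Fin n) (Fin n) ℝ) (B : Matrix (Fin n) (Fin m) ℝ)
    (K : Matrix (Fin m) (Fin n) ℝ)
    (hA : ∀ z ∈ spectrum ℂ (toC A), ‖z‖ ≤ 1)
    (hABK : SchurStable (toC (A - B * K)))
    (D : Matrix (Fin N) (Fin N) ℝ)
    (hDlt : ∀ i j : Fin N, i < j → D i j = 0)
    (hDnonneg : ∀ i j : Fin N, 0 ≤ D i j)
    (hDdiag : ∀ i : Fin N, D i i < 1)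
    (Δ : Matrix (Fin N) (Fin N) ℂ)
    (hΔlt : ∀ i j : Fin N, i < j → Δ i j = 0)
    (hΔdiag : ∀ i : Fin N, Δ i i = (D i i : ℂ))
    (hΔoff : ∀ i j : Fin N, j < i → ∃ z : ℂ, ‖z‖ = 1 ∧ Δ i j = (D i j : ℂ) * z) :
    ∀ z ∈ spectrum ℂ (Matrix.fromBlocks
      ((1 : Matrix (Fin N) (Fin N) ℂ) ⊗ₖ toC (A - B * K))
      ((1 : Matrix (Fin N) (Fin N) ℂ) ⊗ₖ toC (B * K))
      ((toC D - Δ) ⊗ₖ toC A)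
      (Δ ⊗ₖ toC A)), ‖z‖ ≠ 1 := by
  intro z hz hz1
  obtain ⟨v, hv0, hv⟩ := (Matrix.mem_spectrum_iff_exists_mulVec_eq _ z).mp hz
  rw [← Sum.elim_comp_inl_inr v, Matrix.fromBlocks_mulVec] at hv
  set x : Fin N → Fin n → ℂ := fun i a => v (Sum.inl (i, a))
  set y : Fin N → Fin n → ℂ := fun i a => v (Sum.inr (i, a))
  have hxi : ∀ i, toC (A - B * K) *ᵥ x i + toC (B * K) *ᵥ y i = z • x i := by
    intro i
    ext a
    have h := congrFun hv (Sum.inl (i, a))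
    simpa [Matrix.kronecker_mulVec_apply, Matrix.one_apply] using h
  have hyi : ∀ i a, ∑ j, (toC D - Δ) i j * (toC A *ᵥ x j) a + ∑ j, Δ i j * (toC A *ᵥ y j) a
      = z * y i a := by
    intro i a
    have h := congrFun hv (Sum.inr (i, a))
    simpa [Matrix.kronecker_mulVec_apply] using h
  have key : ∀ i, x i = 0 ∧ y i = 0 := by
    intro i
    induction i using WellFoundedLT.induction with
    | ind i ih =>
      have hyz : y i = 0 := by
        refine Matrix.eq_zero_of_smul_mulVec_eq hA (hDnonneg i i) (hDdiag i) hz1 ?_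
        ext a
        have h := hyi i a
        rw [Finset.sum_eq_zero, Finset.sum_eq_single i, hΔdiag, zero_add] at h
        · simpa using h
        · intro j _ hj
          rcases lt_or_gt_of_ne hj with hlt | hgt
          · simp [(ih j hlt).2]
          · simp [hΔlt i j hgt]
        · simp
        · intro j _
          rcases lt_trichotomy j i with hlt | rfl | hgt
          · simp [(ih j hlt).1]
          · simp [toC, hΔdiag]
          · simp [toC, hΔlt i j hgt, hDlt i j hgt]
      refine ⟨?_, hyz⟩
      by_contra hne
      have h := hxi i
      rw [hyz, Matrix.mulVec_zero, add_zero] at h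
      exact (hABK z ((Matrix.mem_spectrum_iff_exists_mulVec_eq _ z).mpr ⟨x i, hne, h⟩)).ne hz1
  apply hv0
  ext (⟨i, a⟩ | ⟨i, a⟩)
  · exact congrFun (key i).1 a
  · exact congrFun (key i).2 a
end

section
/- Let A_r ∈ ℝ^{r×r} have all its eigenvalues on the unit circle and let C_r ∈ ℝ^{p×r} be such that the pair (C_r, A_r) is observable, i.e., the only x ∈ ℝ^r with C_r A_r^k x = 0 for all k ≥ 0 is x = 0. Let ν be the observability index of (C_r, A_r), i.e., the smallest positive integer such that the stacked matrix [C_r; C_r A_r; …; C_r A_r^{ν−1}] has rank r. Then for every integer n_q ≥ ν there exist an integer ř ≥ r and matrices Ǎ_r ∈ ℝ^{ř×ř}, B̌_r ∈ ℝ^{ř×p}, Č_r ∈ ℝ^{p×ř} such that: (i) for every x_{r0} ∈ ℝ^r there exists x̌_{r0} ∈ ℝ^{ř} with C_r A_r^k x_{r0} = Č_r Ǎ_r^k x̌_{r0} for all k ≥ 0 (the new exosystem reproduces every output of the original one); (ii) Č_r Ǎ_r^k B̌_r = 0 for 0 ≤ k ≤ n_q − 2 and Č_r Ǎ_r^{n_q−1}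 B̌_r ∈ ℝ^{p×p} is invertible (the triple (Č_r, Ǎ_r, B̌_r) is invertible of uniform rank n_q); (iii) for every z ∈ ℂ the (ř+p) × (ř+p) Rosenbrock matrix [[zI − Ǎ_r, −B̌_r], [Č_r, 0]] has rank ř + p (the triple has no invariant zeros); and (iv) the characteristic polynomial of Ǎ_r equals z^{ř−r} times the characteristic polynomial of A_r (the eigenvalues of Ǎ_r consist of all eigenvalues of A_r together with additional zero eigenvalues). -/
open Matrix

/-- The ν-step observability matrix [C; CA; …; CA^{ν−1}] of the pair (C, A). -/
noncomputable def obsMat {r p : ℕ} (C : Matrix (Fin p) (Fin r) ℝ)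
    (A : Matrix (Fin r) (Fin r) ℝ) (ν : ℕ) : Matrix (Fin ν × Fin p) (Fin r) ℝ :=
  Matrix.of fun q j => (C * A ^ (q.1 : ℕ)) q.2 j

section DeadbeatFeedback

variable {K V U : Type*} [Field K] [AddCommGroup V] [Module K V] [AddCommGroup U] [Module K U]

/-- A linear choice of the input that steers the next state of `x ↦ f x + B u` into `S`, whenever
this is possible. -/
theorem exists_linear_steering (f : V →ₗ[K] V) (B : U →ₗ[K] V) (S : Submodule K V) :
    ∃ g : V →ₗ[K] U, ∀ x, f x ∈ S ⊔ LinearMap.range B → f x + B (g x) ∈ S := by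
  obtain ⟨h₀, hh₀⟩ := (S.mkQ ∘ₗ B).rangeRestrict.exists_rightInverse_of_surjective
    (S.mkQ ∘ₗ B).range_rangeRestrict
  obtain ⟨h, hh⟩ := h₀.exists_extend
  refine ⟨-(h ∘ₗ S.mkQ ∘ₗ f), fun x hx => ?_⟩
  obtain ⟨s, hs, _, ⟨u, rfl⟩, hsu⟩ := Submodule.mem_sup.1 hx
  have hq : S.mkQ (f x) = (S.mkQ ∘ₗ B) u := by
    rw [← hsu]
    simpa using hs
  have key : (S.mkQ ∘ₗ B) (h (S.mkQ (f x))) = S.mkQ (f x) := by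
    rw [hq]
    have h1 := LinearMap.congr_fun hh ⟨(S.mkQ ∘ₗ B) u, u, rfl⟩
    have h2 := LinearMap.congr_fun hh₀ ⟨(S.mkQ ∘ₗ B) u, u, rfl⟩
    have h3 := congrArg Subtype.val h2
    simp only [LinearMap.comp_apply, Submodule.subtype_apply] at h1 h3 ⊢
    rw [h1]
    exact h3
  have : S.mkQ (f x + B (-(h (S.mkQ (f x))))) = 0 := by
    rw [map_add, map_neg, map_neg]
    simp only [LinearMap.comp_apply] at key
    rw [key, add_neg_cancel]
  exact (Submodule.Quotient.mk_eq_zero S).1 this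

/-- The states of `x ↦ f x + B u` that can be driven into `W` in `k` steps. -/
def steerable (f : V →ₗ[K] V) (B : U →ₗ[K] V) (W : Submodule K V) : ℕ → Submodule K V
  | 0 => W
  | k + 1 => (steerable f B W k ⊔ LinearMap.range B).comap f

variable {f : V →ₗ[K] V} {B : U →ₗ[K] V} {W : Submodule K V} {F₀ : V →ₗ[K] U}

theorem steerable_le_succ (hW : ∀ w ∈ W, f w + B (F₀ w) ∈ W) (k : ℕ) :
    steerable f B W k ≤ steerable f B W (k + 1) := by
  induction k with
  | zero =>
    intro w hw
    refine Submodule.mem_sup.2 ⟨_, hW w hw, _, ⟨-F₀ w, rfl⟩, ?_⟩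
    simp
  | succ k ih => exact Submodule.comap_mono (sup_le_sup_right ih _)

theorem mem_steerable_of_pow_eq_zero (k : ℕ) (x : V) (hx : (f ^ k) x = 0) :
    x ∈ steerable f B W k := by
  induction k generalizing x with
  | zero =>
    rw [pow_zero, Module.End.one_apply] at hx
    rw [hx]
    exact Submodule.zero_mem _
  | succ k ih =>
    rw [pow_succ, Module.End.mul_apply] at hx
    exact Submodule.mem_sup_left (ih (f x) hx)

theorem exists_feedback_steerable (hW : ∀ w ∈ W, f w + B (F₀ w) ∈ W) (k : ℕ) :
    ∃ F : V →ₗ[K] U, (∀ w ∈ W, F w = F₀ w) ∧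
      ∀ j < k, ∀ x ∈ steerable f B W (j + 1), f x + B (F x) ∈ steerable f B W j := by
  induction k with
  | zero => exact ⟨F₀, fun _ _ => rfl, by simp⟩
  | succ k ih =>
    obtain ⟨F, hF, hFk⟩ := ih
    obtain ⟨g, hg⟩ := exists_linear_steering f B (steerable f B W k)
    have hmono := monotone_nat_of_le_succ (steerable_le_succ hW)
    obtain ⟨π, hπ⟩ := (steerable f B W k).subtype.exists_leftInverse_of_injective
      (Submodule.ker_subtype _)
    set P : V →ₗ[K] V := (steerable f B W k).subtype ∘ₗ π with hP
    have hPmem : ∀ x, P x ∈ steerable f B W k := fun x => (π x).2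
    have hPid : ∀ x ∈ steerable f B W k, P x = x := fun x hx =>
      congrArg Subtype.val (LinearMap.congr_fun hπ ⟨x, hx⟩)
    have hF' : ∀ x ∈ steerable f B W k, (F ∘ₗ P + g ∘ₗ (LinearMap.id - P) : V →ₗ[K] U) x = F x := by
      intro x hx
      simp [hPid x hx]
    refine ⟨F ∘ₗ P + g ∘ₗ (LinearMap.id - P), fun w hw => ?_, fun j hj x hx => ?_⟩
    · rw [hF' w (hmono (Nat.zero_le k) hw), hF w hw]
    · rcases Nat.lt_succ_iff_lt_or_eq.1 hj with hjk | rfl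
      · rw [hF' x (hmono hjk hx)]
        exact hFk j hjk x hx
      · have h1 : f (P x) + B (F (P x)) ∈ steerable f B W j := by
          cases j with
          | zero =>
            have hw : P x ∈ W := hPmem x
            rw [hF _ hw]
            exact hW _ hw
          | succ i => exact hmono i.le_succ (hFk i i.lt_succ_self _ (hPmem x))
        have h2 : f (x - P x) + B (g (x - P x)) ∈ steerable f B W j :=
          hg _ (Submodule.sub_mem _ hx (hmono j.le_succ (hPmem x)))
        have h3 := Submodule.add_mem _ h1 h2
        convert h3 using 1
        simp only [LinearMap.add_apply, LinearMap.comp_apply, LinearMap.sub_apply,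
          LinearMap.id_apply, map_add, map_sub]
        abel

/-- Deadbeat feedback towards an invariant subspace: if `f` is nilpotent and `F₀` renders `W`
invariant, some feedback agreeing with `F₀` on `W` drives every state into `W`. -/
theorem exists_deadbeat_feedback (hW : ∀ w ∈ W, f w + B (F₀ w) ∈ W) (n : ℕ) (hn : f ^ n = 0) :
    ∃ F : V →ₗ[K] U, (∀ w ∈ W, F w = F₀ w) ∧ ∀ x, ((f + B ∘ₗ F) ^ n) x ∈ W := by
  obtain ⟨F, hF, hFn⟩ := exists_feedback_steerable hW n
  have key : ∀ k ≤ n, ∀ x ∈ steerable f B W k, ((f + B ∘ₗ F) ^ k) x ∈ W := by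
    intro k
    induction k with
    | zero => exact fun _ x hx => hx
    | succ k ih =>
      intro hk x hx
      rw [pow_succ, Module.End.mul_apply]
      exact ih (by omega) _ (hFn k hk x hx)
  exact ⟨F, hF, fun x => key n le_rfl x (mem_steerable_of_pow_eq_zero n x (by rw [hn]; rfl))⟩

end DeadbeatFeedback

/-- If `O` embeds the dynamics `M` into the dynamics `A` and some power of `A` maps into the range
of `O`, then `A` and `M` have the same characteristic polynomial up to a power of `X`. -/
theorem charpoly_of_intertwining {K m ι : Type*} [Field K] [Fintype m] [DecidableEq m] [Fintype ι]
    [DecidableEq ι] (A : Matrix ι ι K) (M : Matrix m m K) (O : Matrix ι m K) (L : Matrix m ι K)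
    (hLO : L * O = 1) (hAO : A * O = O * M) (n : ℕ) (hA : (1 - O * L) * A ^ n = 0) :
    Polynomial.X ^ Fintype.card m * A.charpoly = Polynomial.X ^ Fintype.card ι * M.charpoly := by
  set Q : Matrix ι ι K := 1 - O * L with hQ
  have hQO : Q * O = 0 := by
    rw [hQ, Matrix.sub_mul, Matrix.mul_assoc, hLO, Matrix.one_mul, Matrix.mul_one, sub_self]
  have hQAO : Q * A * O = 0 := by rw [Matrix.mul_assoc, hAO, ← Matrix.mul_assoc, hQO, Matrix.zero_mul]
  have hQAQ : Q * A * Q = Q * A := by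
    conv_lhs => rw [hQ]
    rw [Matrix.mul_sub, ← hQ, Matrix.mul_one, ← Matrix.mul_assoc, hQAO, Matrix.zero_mul, sub_zero]
  have hpow : ∀ k, Q * A ^ k * Q = Q * A ^ k := by
    intro k
    induction k with
    | zero =>
      rw [pow_zero, mul_one]
      conv_lhs => rw [hQ]
      rw [Matrix.mul_sub, ← hQ, Matrix.mul_one, ← Matrix.mul_assoc, hQO, Matrix.zero_mul, sub_zero]
    | succ k ih =>
      rw [pow_succ, ← mul_assoc, ← ih, mul_assoc (Q * A ^ k), mul_assoc (Q * A ^ k), hQAQ]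
  have hnil : IsNilpotent (Q * A) := by
    refine ⟨n + 1, ?_⟩
    have : ∀ k, (Q * A) ^ (k + 1) = Q * A ^ (k + 1) := by
      intro k
      induction k with
      | zero => simp
      | succ k ih => rw [pow_succ, ih, ← mul_assoc, hpow, pow_succ A (k + 1), ← mul_assoc]
    rw [this, pow_succ, ← mul_assoc, hA, zero_mul]
  have hchar : (Q * A).charpoly = Polynomial.X ^ Fintype.card ι :=
    sub_eq_zero.1 (Matrix.isNilpotent_charpoly_sub_pow_of_isNilpotent hnil).eq_zero
  have h1 : fromCols O Q * fromRows (L * A) (Q * A) = A := by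
    rw [fromCols_mul_fromRows, ← Matrix.mul_assoc, ← Matrix.mul_assoc, ← Matrix.add_mul]
    have : Q * Q = Q := by simpa using hpow 0
    rw [this, hQ, add_sub_cancel, Matrix.one_mul]
  have h2 : fromRows (L * A) (Q * A) * fromCols O Q = fromBlocks M (L * A * Q) 0 (Q * A) := by
    rw [fromRows_mul_fromCols, hQAO, hQAQ, Matrix.mul_assoc, hAO, ← Matrix.mul_assoc, hLO,
      Matrix.one_mul]
  have h3 := charpoly_mul_comm' (fromCols O Q) (fromRows (L * A) (Q * A))
  rw [h1, h2, charpoly_fromBlocks_zero₂₁, hchar, Fintype.card_sum, pow_add, mul_comm M.charpoly,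
    mul_comm (_ ^ Fintype.card m), mul_assoc] at h3
  exact mul_left_cancel₀ (pow_ne_zero _ Polynomial.X_ne_zero) h3

section IntegratorChain

variable {R : Type*} [CommRing R] {m p : ℕ} {κ : Type*}

/-- The matrix reading off the `k`-th block of a state with `m + 1` blocks of size `p`. -/
def blockRow (R : Type*) [CommRing R] (m p k : ℕ) : Matrix (Fin p) (Fin (m + 1) × Fin p) R :=
  Matrix.of fun a q => if (q.1 : ℕ) = k ∧ q.2 = a then 1 else 0

/-- The block shift on states with `m + 1` blocks of size `p`. -/
def blockShift (R : Type*) [CommRing R] (m p : ℕ) :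
    Matrix (Fin (m + 1) × Fin p) (Fin (m + 1) × Fin p) R :=
  Matrix.of fun q q' => if (q'.1 : ℕ) = q.1 + 1 ∧ q'.2 = q.2 then 1 else 0

/-- The matrix feeding an input into the last of `m + 1` blocks of size `p`. -/
def lastBlock (R : Type*) [CommRing R] (m p : ℕ) : Matrix (Fin (m + 1) × Fin p) (Fin p) R :=
  Matrix.of fun q b => if (q.1 : ℕ) = m ∧ q.2 = b then 1 else 0

theorem blockRow_mul_apply (k : ℕ) (hk : k < m + 1) (M : Matrix (Fin (m + 1) × Fin p) κ R)
    (a : Fin p) (c : κ) : (blockRow R m p k * M) a c = M (⟨k, hk⟩, a) c := by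
  rw [Matrix.mul_apply, Finset.sum_eq_single (⟨k, hk⟩, a)]
  · simp [blockRow]
  · rintro ⟨i, b⟩ - hne
    have : ¬((i : ℕ) = k ∧ b = a) := by
      rintro ⟨rfl, rfl⟩
      exact hne rfl
    simp [blockRow, this]
  · simp

theorem blockRow_eq_zero (k : ℕ) (hk : m < k) : blockRow R m p k = 0 := by
  ext a q
  have : (q.1 : ℕ) ≠ k := by omega
  simp [blockRow, this]

theorem blockRow_mul_blockShift (k : ℕ) :
    blockRow R m p k * blockShift R m p = blockRow R m p (k + 1) := by
  by_cases hk : k < m + 1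
  · ext a q
    rw [blockRow_mul_apply k hk]
    simp [blockRow, blockShift]
  · rw [blockRow_eq_zero k (by omega), blockRow_eq_zero (k + 1) (by omega), Matrix.zero_mul]

theorem blockRow_mul_lastBlock_of_ne (k : ℕ) (hk : k ≠ m) :
    blockRow R m p k * lastBlock R m p = 0 := by
  by_cases hk' : k < m + 1
  · ext a q
    rw [blockRow_mul_apply k hk']
    simp [lastBlock, hk]
  · rw [blockRow_eq_zero k (by omega), Matrix.zero_mul]

theorem blockRow_mul_lastBlock : blockRow R m p m * lastBlock R m p = 1 := by
  ext a b
  rw [blockRow_mul_apply m (by omega)]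
  simp [lastBlock, Matrix.one_apply]

theorem ext_blockRow_mul {M M' : Matrix (Fin (m + 1) × Fin p) κ R}
    (h : ∀ k < m + 1, blockRow R m p k * M = blockRow R m p k * M') : M = M' := by
  ext ⟨k, a⟩ c
  have := congrFun (congrFun (h k k.2) a) c
  rwa [blockRow_mul_apply k k.2, blockRow_mul_apply k k.2] at this

theorem blockRow_mul_blockShift_pow (k j : ℕ) :
    blockRow R m p k * blockShift R m p ^ j = blockRow R m p (k + j) := by
  induction j with
  | zero => simp
  | succ j ih => rw [pow_succ, ← Matrix.mul_assoc, ih, blockRow_mul_blockShift, add_assoc]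

theorem blockShift_pow_eq_zero : blockShift R m p ^ (m + 1) = 0 := by
  refine ext_blockRow_mul fun k _ => ?_
  rw [blockRow_mul_blockShift_pow, blockRow_eq_zero _ (by omega), Matrix.mul_zero]

theorem blockRow_mul_closedLoop (F : Matrix (Fin p) (Fin (m + 1) × Fin p) R) (k : ℕ)
    (hk : k ≠ m) :
    blockRow R m p k * (blockShift R m p + lastBlock R m p * F) = blockRow R m p (k + 1) := by
  rw [Matrix.mul_add, blockRow_mul_blockShift, ← Matrix.mul_assoc,
    blockRow_mul_lastBlock_of_ne k hk, Matrix.zero_mul, add_zero]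

theorem blockRow_last_mul_closedLoop (F : Matrix (Fin p) (Fin (m + 1) × Fin p) R) :
    blockRow R m p m * (blockShift R m p + lastBlock R m p * F) = F := by
  rw [Matrix.mul_add, blockRow_mul_blockShift, ← Matrix.mul_assoc, blockRow_mul_lastBlock,
    Matrix.one_mul, blockRow_eq_zero _ m.lt_succ_self, zero_add]

theorem blockRow_zero_mul_closedLoop_pow (F : Matrix (Fin p) (Fin (m + 1) × Fin p) R) (k : ℕ)
    (hk : k ≤ m) :
    blockRow R m p 0 * (blockShift R m p + lastBlock R m p * F) ^ k = blockRow R m p k := by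
  induction k with
  | zero => simp
  | succ k ih =>
    rw [pow_succ, ← Matrix.mul_assoc, ih (by omega), blockRow_mul_closedLoop F k (by omega)]

theorem map_blockRow {S : Type*} [CommRing S] (φ : R →+* S) (k : ℕ) :
    (blockRow R m p k).map φ = blockRow S m p k := by
  ext a q
  simp [blockRow, apply_ite φ]

theorem map_blockShift {S : Type*} [CommRing S] (φ : R →+* S) :
    (blockShift R m p).map φ = blockShift S m p := by
  ext a q
  simp [blockShift, apply_ite φ]

theorem map_lastBlock {S : Type*} [CommRing S] (φ : R →+* S) :
    (lastBlock R m p).map φ = lastBlock S m p := by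
  ext a q
  simp [lastBlock, apply_ite φ]

theorem rank_rosenbrock_closedLoop {K : Type*} [Field K]
    (F : Matrix (Fin p) (Fin (m + 1) × Fin p) K) (z : K) :
    (Matrix.fromBlocks (z • (1 : Matrix (Fin (m + 1) × Fin p) (Fin (m + 1) × Fin p) K) -
      (blockShift K m p + lastBlock K m p * F)) (-lastBlock K m p) (blockRow K m p 0)
      (0 : Matrix (Fin p) (Fin p) K)).rank = (m + 1) * p + p := by
  set A := blockShift K m p + lastBlock K m p * F with hA
  have hinj : ∀ v, Matrix.fromBlocks (z • 1 - A) (-lastBlock K m p) (blockRow K m p 0)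
      (0 : Matrix (Fin p) (Fin p) K) *ᵥ v = 0 → v = 0 := by
    intro v hv
    rw [fromBlocks_mulVec] at hv
    set x := v ∘ Sum.inl with hx
    set u := v ∘ Sum.inr with hu
    have h1 : (z • 1 - A) *ᵥ x + (-lastBlock K m p) *ᵥ u = 0 :=
      funext fun i => congrFun hv (Sum.inl i)
    have h2 : blockRow K m p 0 *ᵥ x = 0 := by
      have : blockRow K m p 0 *ᵥ x + (0 : Matrix (Fin p) (Fin p) K) *ᵥ u = 0 :=
        funext fun i => congrFun hv (Sum.inr i)
      rwa [zero_mulVec, add_zero] at this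
    have h3 : ∀ k, z • (blockRow K m p k *ᵥ x) - (blockRow K m p k * A) *ᵥ x
        - (blockRow K m p k * lastBlock K m p) *ᵥ u = 0 := by
      intro k
      have := congrArg (fun w => blockRow K m p k *ᵥ w) h1
      simp only [mulVec_add, mulVec_zero, sub_mulVec, neg_mulVec, smul_mulVec, one_mulVec,
        mulVec_sub, mulVec_neg, mulVec_smul, mulVec_mulVec] at this
      rw [← this, sub_eq_add_neg _ ((_ * lastBlock K m p) *ᵥ u)]
    have h4 : ∀ k < m + 1, blockRow K m p k *ᵥ x = 0 := by
      intro k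
      induction k with
      | zero => exact fun _ => h2
      | succ k ih =>
        intro hk
        have := h3 k
        rw [ih (by omega), hA, blockRow_mul_closedLoop F k (by omega),
          blockRow_mul_lastBlock_of_ne k (by omega)] at this
        simpa using this
    have hx0 : x = 0 := by
      have : Matrix.replicateCol Unit x = 0 := by
        refine ext_blockRow_mul fun k hk => ?_
        rw [← Matrix.replicateCol_mulVec, h4 k hk]
        simp
      simpa using this
    have hu0 : u = 0 := by
      have := h3 m
      rw [hx0, blockRow_mul_lastBlock] at this
      simpa using this
    ext (i | i)
    · exact congrFun hx0 i
    · exact congrFun hu0 i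
  have := LinearMap.finrank_range_of_inj
    (f := (Matrix.fromBlocks (z • 1 - A) (-lastBlock K m p) (blockRow K m p 0)
      (0 : Matrix (Fin p) (Fin p) K)).mulVecLin)
    ((injective_iff_map_eq_zero _).2 hinj)
  rw [Matrix.rank, this]
  simp

end IntegratorChain

theorem mulVec_injective_of_rank_eq {K ι : Type*} [Field K] [Fintype ι] {r : ℕ}
    (M : Matrix ι (Fin r) K) (h : M.rank = r) : Function.Injective M.mulVec := by
  have h1 := M.mulVecLin.finrank_range_add_finrank_ker
  rw [← Matrix.rank, h, Module.finrank_fin_fun] at h1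
  have h2 : LinearMap.ker M.mulVecLin = ⊥ := Submodule.finrank_eq_zero.1 (by omega)
  exact LinearMap.ker_eq_bot.1 h2

theorem exists_left_inverse_of_mulVec_injective {K ι κ : Type*} [Field K] [Fintype ι]
    [DecidableEq ι] [Fintype κ] [DecidableEq κ] (M : Matrix ι κ K)
    (h : Function.Injective M.mulVec) : ∃ L : Matrix κ ι K, L * M = 1 := by
  obtain ⟨g, hg⟩ := (Matrix.toLin' M).exists_leftInverse_of_injective (LinearMap.ker_eq_bot.2 h)
  refine ⟨LinearMap.toMatrix' g, ?_⟩
  refine Matrix.toLin'.injective ?_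
  rw [Matrix.toLin'_mul, Matrix.toLin'_toMatrix', hg, Matrix.toLin'_one]

section Observability

variable {r p : ℕ} {C : Matrix (Fin p) (Fin r) ℝ} {A : Matrix (Fin r) (Fin r) ℝ}

theorem blockRow_mul_obsMat {m : ℕ} (k : ℕ) (hk : k < m + 1) :
    blockRow ℝ m p k * obsMat C A (m + 1) = C * A ^ k := by
  ext a j
  rw [blockRow_mul_apply k hk]
  rfl

theorem obsMat_mulVec_injective_mono {ν n : ℕ} (hn : ν ≤ n)
    (h : Function.Injective (obsMat C A ν).mulVec) :
    Function.Injective (obsMat C A n).mulVec := by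
  intro x y hxy
  refine h (funext fun q => ?_)
  exact congrFun hxy (⟨q.1, q.1.2.trans_le hn⟩, q.2)

/-- A feedback for the chain of `m + 1` integrators under which the observability matrix embeds
the dynamics `A`, and every state enters the range of that embedding after `m + 1` steps. -/
theorem exists_embedding_feedback {m : ℕ} {L : Matrix (Fin r) (Fin (m + 1) × Fin p) ℝ}
    (hL : L * obsMat C A (m + 1) = 1) :
    ∃ F : Matrix (Fin p) (Fin (m + 1) × Fin p) ℝ,
      (blockShift ℝ m p + lastBlock ℝ m p * F) * obsMat C A (m + 1) = obsMat C A (m + 1) * A ∧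
      (1 - obsMat C A (m + 1) * L) * (blockShift ℝ m p + lastBlock ℝ m p * F) ^ (m + 1) = 0 := by
  set O := obsMat C A (m + 1) with hO
  have hF₀ : ∀ F : Matrix (Fin p) (Fin (m + 1) × Fin p) ℝ, F * O = C * A ^ (m + 1) →
      (blockShift ℝ m p + lastBlock ℝ m p * F) * O = O * A := by
    intro F hF
    refine ext_blockRow_mul fun k hk => ?_
    rw [← Matrix.mul_assoc, ← Matrix.mul_assoc, hO, blockRow_mul_obsMat k hk, Matrix.mul_assoc C,
      ← pow_succ]
    rcases Nat.lt_succ_iff_lt_or_eq.1 hk with hk' | rfl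
    · rw [blockRow_mul_closedLoop F k hk'.ne, blockRow_mul_obsMat _ (by omega)]
    · rw [blockRow_last_mul_closedLoop, ← hO, hF]
  have hL₀ : C * A ^ (m + 1) * L * O = C * A ^ (m + 1) := by
    rw [Matrix.mul_assoc _ L, hL, Matrix.mul_one]
  obtain ⟨F, hF, hFn⟩ := exists_deadbeat_feedback (f := Matrix.toLin' (blockShift ℝ m p))
    (B := Matrix.toLin' (lastBlock ℝ m p)) (W := LinearMap.range (Matrix.toLin' O))
    (F₀ := Matrix.toLin' (C * A ^ (m + 1) * L)) (by
      rintro _ ⟨x, rfl⟩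
      refine ⟨A *ᵥ x, ?_⟩
      simp only [Matrix.toLin'_apply, Matrix.mulVec_mulVec]
      rw [← hF₀ _ hL₀, ← Matrix.add_mulVec, Matrix.add_mul, Matrix.mul_assoc (lastBlock ℝ m p)])
    (m + 1) (by rw [← Matrix.toLin'_pow, blockShift_pow_eq_zero, map_zero])
  have hFF : Matrix.toLin' (blockShift ℝ m p) + Matrix.toLin' (lastBlock ℝ m p) ∘ₗ F =
      Matrix.toLin' (blockShift ℝ m p + lastBlock ℝ m p * LinearMap.toMatrix' F) := by
    rw [map_add, Matrix.toLin'_mul, Matrix.toLin'_toMatrix']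
  refine ⟨LinearMap.toMatrix' F, hF₀ _ ?_, ?_⟩
  · rw [← hL₀]
    refine Matrix.toLin'.injective (LinearMap.ext fun x => ?_)
    rw [Matrix.toLin'_mul, Matrix.toLin'_mul _ O, Matrix.toLin'_toMatrix']
    exact hF _ ⟨x, rfl⟩
  · refine Matrix.toLin'.injective (LinearMap.ext fun x => ?_)
    obtain ⟨y, hy⟩ := hFn x
    rw [hFF, ← Matrix.toLin'_pow] at hy
    rw [Matrix.toLin'_mul, LinearMap.comp_apply, ← hy, ← LinearMap.comp_apply,
      ← Matrix.toLin'_mul, Matrix.sub_mul, Matrix.mul_assoc, hL, Matrix.one_mul, Matrix.mul_one,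
      sub_self]
    simp

end Observability

/-- Lemma 1 of the paper: remodeling of the exosystem into a target model
(Č_r, Ǎ_r, B̌_r) that reproduces all outputs of the original exosystem, is
invertible of uniform rank n_q, and has no invariant zeros; the eigenvalues of
Ǎ_r are those of A_r together with additional zero eigenvalues. -/
theorem stmt12
    (r p : ℕ) (hr : 0 < r) (hp : 0 < p)
    (Ar : Matrix (Fin r) (Fin r) ℝ) (Cr : Matrix (Fin p) (Fin r) ℝ)
    -- all eigenvalues of A_r lie on the unit circle
    (hAr : ∀ z ∈ spectrum ℂ (toC Ar), ‖z‖ = 1)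
    -- (C_r, A_r) observable
    (hobs : ∀ x : Fin r → ℝ, (∀ k : ℕ, (Cr * Ar ^ k).mulVec x = 0) → x = 0)
    -- ν is the observability index of (C_r, A_r)
    (ν : ℕ) (hν : 0 < ν)
    (hνrank : (obsMat Cr Ar ν).rank = r)
    (hνmin : ∀ μ : ℕ, 0 < μ → μ < ν → (obsMat Cr Ar μ).rank ≠ r)
    -- n_q ≥ ν
    (nq : ℕ) (hnq : ν ≤ nq) :
    ∃ (rcheck : ℕ) (_ : r ≤ rcheck) (Acheck : Matrix (Fin rcheck) (Fin rcheck) ℝ)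
      (Bcheck : Matrix (Fin rcheck) (Fin p) ℝ) (Ccheck : Matrix (Fin p) (Fin rcheck) ℝ),
      -- (i) the new exosystem reproduces every output of the original one
      (∀ x0 : Fin r → ℝ, ∃ y0 : Fin rcheck → ℝ, ∀ k : ℕ,
        (Cr * Ar ^ k).mulVec x0 = (Ccheck * Acheck ^ k).mulVec y0) ∧
      -- (ii) uniform rank n_q: first n_q − 1 Markov parameters vanish and the
      -- n_q-th is invertible
      (∀ k : ℕ, k + 2 ≤ nq → Ccheck * Acheck ^ k * Bcheck = 0) ∧
      IsUnit (Ccheck * Acheck ^ (nq - 1) * Bcheck) ∧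
      -- (iii) no invariant zeros: the Rosenbrock matrix has full rank for all z ∈ ℂ
      (∀ z : ℂ,
        (Matrix.fromBlocks (z • (1 : Matrix (Fin rcheck) (Fin rcheck) ℂ) - toC Acheck)
          (-(toC Bcheck)) (toC Ccheck) (0 : Matrix (Fin p) (Fin p) ℂ)).rank = rcheck + p) ∧
      -- (iv) char. polynomial of Ǎ_r is z^{ř−r} times that of A_r
      Acheck.charpoly = Polynomial.X ^ (rcheck - r) * Ar.charpoly := by
  obtain ⟨m, rfl⟩ : ∃ m, nq = m + 1 := ⟨nq - 1, by omega⟩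
  have hinj := obsMat_mulVec_injective_mono hnq (mulVec_injective_of_rank_eq _ hνrank)
  obtain ⟨L, hL⟩ := exists_left_inverse_of_mulVec_injective _ hinj
  obtain ⟨F, hFO, hFn⟩ := exists_embedding_feedback hL
  have hchar := charpoly_of_intertwining _ _ _ _ hL hFO _ hFn
  have hrank : ∀ z : ℂ, _ := rank_rosenbrock_closedLoop (F.map Complex.ofRealHom)
  have hle : r ≤ (m + 1) * p := by
    have := LinearMap.finrank_le_finrank_of_injective
      (f := (obsMat Cr Ar (m + 1)).mulVecLin) hinj
    simpa using this
  have hpow := blockRow_zero_mul_closedLoop_pow F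
  set A := blockShift ℝ m p + lastBlock ℝ m p * F with hA
  have hApow : ∀ k, A ^ k * obsMat Cr Ar (m + 1) = obsMat Cr Ar (m + 1) * Ar ^ k := by
    intro k
    induction k with
    | zero => simp
    | succ k ih =>
      rw [pow_succ, Matrix.mul_assoc, hFO, ← Matrix.mul_assoc, ih, Matrix.mul_assoc, ← pow_succ]
  let e : Fin (m + 1) × Fin p ≃ Fin ((m + 1) * p) := finProdFinEquiv
  have hCA : ∀ k, (blockRow ℝ m p 0).submatrix id e.symm * (A.submatrix e.symm e.symm) ^ k =
      (blockRow ℝ m p 0 * A ^ k).submatrix id e.symm := by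
    intro k
    induction k with
    | zero => simp
    | succ k ih =>
      rw [pow_succ, ← Matrix.mul_assoc, ih, Matrix.submatrix_mul_equiv, Matrix.mul_assoc,
        ← pow_succ]
  refine ⟨(m + 1) * p, hle, A.submatrix e.symm e.symm, (lastBlock ℝ m p).submatrix e.symm id,
    (blockRow ℝ m p 0).submatrix id e.symm, fun x0 => ?_, fun k hk => ?_, ?_, fun z => ?_, ?_⟩
  · refine ⟨((obsMat Cr Ar (m + 1)).submatrix e.symm id) *ᵥ x0, fun k => ?_⟩
    rw [hCA, Matrix.mulVec_mulVec, Matrix.submatrix_mul_equiv, Matrix.mul_assoc, hApow,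
      ← Matrix.mul_assoc, blockRow_mul_obsMat 0 (by omega), pow_zero, Matrix.mul_one,
      Matrix.submatrix_id_id]
  · rw [hCA, Matrix.submatrix_mul_equiv, hpow k (by omega),
      blockRow_mul_lastBlock_of_ne k (by omega)]
    rfl
  · rw [hCA, Matrix.submatrix_mul_equiv, Nat.add_sub_cancel, hpow m le_rfl, blockRow_mul_lastBlock]
    simp
  · rw [← hrank z, ← Matrix.rank_submatrix _ (Equiv.sumCongr e (Equiv.refl (Fin p))).symm
      (Equiv.sumCongr e (Equiv.refl (Fin p))).symm]
    have hAC : toC A = blockShift ℂ m p + lastBlock ℂ m p * F.map Complex.ofRealHom := by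
      change A.map Complex.ofRealHom = _
      rw [hA, Matrix.map_add _ (map_add _), Matrix.map_mul, map_blockShift, map_lastBlock]
    have hBC : toC (lastBlock ℝ m p) = lastBlock ℂ m p := map_lastBlock Complex.ofRealHom
    have hCC : toC (blockRow ℝ m p 0) = blockRow ℂ m p 0 := map_blockRow Complex.ofRealHom 0
    rw [← hAC, ← hBC, ← hCC]
    congr 1
    ext (i | i) (j | j) <;> simp [toC, Matrix.one_apply]
  · have hre : (A.submatrix e.symm e.symm).charpoly = A.charpoly := Matrix.charpoly_reindex e A
    rw [hre]
    refine mul_left_cancel₀ (pow_ne_zero r Polynomial.X_ne_zero) ?_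
    rw [← mul_assoc, ← pow_add, Nat.add_sub_cancel' hle]
    simpa using hchar
end
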